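/- arXiv:1411.7497 — 2 statements merged into one kernel-verified Lean document; each statement's English description precedes it below -/
import Mathlib

section
/- For fixed β ∈ (0,1), the function α ↦ 2/α - [₂F₁(β, α+β, 1+α+β; -1) + ₂F₁(β, α+β, 1+α+β; 1)]/(α+β) is strictly decreasing on (0,2). -/
/-- The Gauss hypergeometric function `₂F₁(a,b,c;z)`, via the Euler integral
representation (valid for `c > b > 0`). -/
noncomputable def hyp2F1 (a b c z : ℝ) : ℝ :=
  (Real.Gamma c / (Real.Gamma b * Real.Gamma (c - b))) *
    ∫ t in (0:ℝ)..1, t ^ (b - 1) * (1 - t) ^ (c - b - 1) * (1 - t * z) ^ (-a)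

lemma tc_integrable_aux (α β : ℝ) (hα : 0 < α) (h0 : 0 < β) (h1 : β < 1) :
    IntervalIntegrable (fun t : ℝ => t ^ (α + β - 1) * (1 - t) ^ (-β)) MeasureTheory.volume 0 1 := by
  have hg1 : IntervalIntegrable (fun t : ℝ => t ^ (α + β - 1)) MeasureTheory.volume 0 1 :=
    intervalIntegral.intervalIntegrable_rpow' (by linarith)
  have hg2 : IntervalIntegrable (fun t : ℝ => (1 - t) ^ (-β)) MeasureTheory.volume 0 1 := by
    have := (intervalIntegral.intervalIntegrable_rpow' (a := 0) (b := 1) (r := -β)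
      (by linarith)).comp_sub_left 1
    simpa using this.symm
  refine IntervalIntegrable.mono_fun' ((hg1.add hg2).const_mul 2) ?_ ?_
  · exact Measurable.aestronglyMeasurable (by fun_prop)
  · rw [Set.uIoc_of_le zero_le_one, ← MeasureTheory.Measure.restrict_congr_set
      (MeasureTheory.Ioo_ae_eq_Ioc)]
    filter_upwards [MeasureTheory.ae_restrict_mem measurableSet_Ioo] with t ht
    have ht0 : 0 < t := ht.1
    have ht1 : 0 < 1 - t := by linarith [ht.2]
    have p1 : 0 < t ^ (α + β - 1) := Real.rpow_pos_of_pos ht0 _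
    have p2 : 0 < (1 - t) ^ (-β) := Real.rpow_pos_of_pos ht1 _
    rw [Real.norm_of_nonneg (by positivity)]
    have key : ∀ x : ℝ, ∀ r : ℝ, 1 / 2 ≤ x → x ≤ 1 → -1 ≤ r → x ^ r ≤ 2 := by
      intro x r hx hx1 hr
      have hx0 : 0 < x := by linarith
      calc x ^ r ≤ x ^ (-1 : ℝ) := Real.rpow_le_rpow_of_exponent_ge hx0 hx1 hr
        _ = x⁻¹ := Real.rpow_neg_one x
        _ ≤ 2 := by rw [inv_le_comm₀ hx0 (by norm_num)]; linarith
    rcases le_total t (1 / 2) with h | h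
    · have := key (1 - t) (-β) (by linarith) (by linarith) (by linarith)
      nlinarith
    · have := key t (α + β - 1) h (by linarith) (by linarith)
      nlinarith

lemma tc_integrable_aux2 (α β : ℝ) (hα : 0 < α) (h0 : 0 < β) :
    IntervalIntegrable (fun t : ℝ => t ^ (α + β - 1) * (1 + t) ^ (-β)) MeasureTheory.volume 0 1 := by
  have hg1 : IntervalIntegrable (fun t : ℝ => t ^ (α + β - 1)) MeasureTheory.volume 0 1 :=
    intervalIntegral.intervalIntegrable_rpow' (by linarith)
  refine hg1.mul_continuousOn ?_
  rw [Set.uIcc_of_le zero_le_one]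
  refine ContinuousOn.rpow_const (by fun_prop) ?_
  intro x hx
  left
  linarith [hx.1]

lemma tc_hyp (α β z : ℝ) (hα : 0 < α) (h0 : 0 < β) :
    hyp2F1 β (α + β) (1 + α + β) z / (α + β) =
      ∫ t in (0:ℝ)..1, t ^ (α + β - 1) * (1 - t * z) ^ (-β) := by
  have hb : 0 < α + β := by linarith
  have e1 : 1 + α + β - (α + β) = 1 := by ring
  have e2 : 1 + α + β = (α + β) + 1 := by ring
  have hG : Real.Gamma (α + β) ≠ 0 := (Real.Gamma_pos_of_pos hb).ne'
  unfold hyp2F1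
  rw [e1, e2, Real.Gamma_add_one hb.ne']
  simp only [sub_self, Real.rpow_zero, mul_one, Real.Gamma_one]
  generalize (∫ t in (0:ℝ)..1, t ^ (α + β - 1) * (1 - t * z) ^ (-β)) = I
  field_simp

lemma tc_pow (x β : ℝ) (hx : 0 < x) (h0 : 0 < β) (h1 : β < 1) :
    x ^ β ≤ 1 - β + β * x := by
  have := Real.geom_mean_le_arith_mean2_weighted h0.le (by linarith : 0 ≤ 1 - β) hx.le
    zero_le_one (by ring)
  simp only [Real.one_rpow, mul_one] at this
  linarith

lemma tc_log (t : ℝ) (ht0 : 0 < t) (ht1 : t < 1) :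
    -Real.log t * (2 * t) ≤ 1 - t ^ 2 := by
  have h : Real.log t⁻¹ ≤ Real.sinh (Real.log t⁻¹) :=
    Real.self_le_sinh_iff.2 (Real.log_nonneg ((one_le_inv₀ ht0).2 ht1.le))
  rw [Real.sinh_log (by positivity), Real.log_inv, inv_inv] at h
  have h2 := mul_le_mul_of_nonneg_right h (by positivity : 0 ≤ 2 * t)
  have e : (t⁻¹ - t) / 2 * (2 * t) = 1 - t ^ 2 := by field_simp
  linarith

lemma tc_pointwise (a b β t : ℝ) (hab : a < b) (h0 : 0 < β) (h1 : β < 1)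
    (ht0 : 0 < t) (ht1 : t < 1) :
    (t ^ (a + β - 1) * (1 + t) ^ (-β) + t ^ (a + β - 1) * (1 - t) ^ (-β)) -
      (t ^ (b + β - 1) * (1 + t) ^ (-β) + t ^ (b + β - 1) * (1 - t) ^ (-β)) ≤
    2 * (1 - β) * (t ^ (a - 1) - t ^ (b - 1)) + β * (b - a) * t ^ (a - 1) := by
  have hm : 0 < 1 - t := by linarith
  have hp : 0 < 1 + t := by linarith
  have ea : t ^ (a + β - 1) = t ^ (a - 1) * t ^ β := by
    rw [← Real.rpow_add ht0]; congr 1; ring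
  have eb : t ^ (b + β - 1) = t ^ (b - 1) * t ^ β := by
    rw [← Real.rpow_add ht0]; congr 1; ring
  have ed : t ^ (b - 1) = t ^ (a - 1) * t ^ (b - a) := by
    rw [← Real.rpow_add ht0]; congr 1; ring
  have q : ∀ u : ℝ, 0 < u → t ^ β * u ^ (-β) ≤ 1 - β + β * (t / u) := by
    intro u hu
    have := tc_pow (t / u) β (by positivity) h0 h1
    rwa [Real.div_rpow ht0.le hu.le, div_eq_mul_inv, ← Real.rpow_neg hu.le] at this
  have qm := q _ hm
  have qp := q _ hp
  have hA : 0 < t ^ (a - 1) := Real.rpow_pos_of_pos ht0 _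
  have hD : t ^ (b - a) ≤ 1 := Real.rpow_le_one ht0.le ht1.le (by linarith)
  have hE : 1 - t ^ (b - a) ≤ (b - a) * (-Real.log t) := by
    have := Real.add_one_le_exp (Real.log t * (b - a))
    rw [← Real.rpow_def_of_pos ht0] at this
    linarith
  have hS : t / (1 - t) + t / (1 + t) = 2 * t / (1 - t ^ 2) := by
    have : 1 - t ^ 2 ≠ 0 := by nlinarith
    field_simp
    ring
  have hw : (1 - t ^ (b - a)) * (t / (1 - t) + t / (1 + t)) ≤ b - a := by
    have hpos : 0 < 1 - t ^ 2 := by nlinarith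
    rw [hS, ← mul_div_assoc, div_le_iff₀ hpos]
    calc (1 - t ^ (b - a)) * (2 * t) ≤ ((b - a) * (-Real.log t)) * (2 * t) := by gcongr
      _ = (b - a) * (-Real.log t * (2 * t)) := by ring
      _ ≤ (b - a) * (1 - t ^ 2) :=
        mul_le_mul_of_nonneg_left (tc_log t ht0 ht1) (by linarith)
  rw [ea, eb, ed]
  set A := t ^ (a - 1)
  set D := t ^ (b - a)
  have h3 : (A * (1 - D)) * (t ^ β * (1 + t) ^ (-β) + t ^ β * (1 - t) ^ (-β)) ≤
      (A * (1 - D)) * (2 * (1 - β) + β * (t / (1 - t) + t / (1 + t))) := by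
    apply mul_le_mul_of_nonneg_left
    · linarith
    · exact mul_nonneg hA.le (by linarith)
  have h4 := mul_le_mul_of_nonneg_left hw (mul_nonneg hA.le h0.le)
  linarith

theorem strictAntiOn_transience_constant (β : ℝ) (hβ : β ∈ Set.Ioo (0 : ℝ) 1) :
    StrictAntiOn
      (fun α : ℝ => 2 / α -
        (hyp2F1 β (α + β) (1 + α + β) (-1) + hyp2F1 β (α + β) (1 + α + β) 1) / (α + β))
      (Set.Ioo (0 : ℝ) 2) := by
  obtain ⟨h0, h1⟩ := hβ
  intro a ha b hb hab
  obtain ⟨ha0, ha2⟩ := ha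
  obtain ⟨hb0, hb2⟩ := hb
  have hJ : ∀ α : ℝ, 0 < α →
      (hyp2F1 β (α + β) (1 + α + β) (-1) + hyp2F1 β (α + β) (1 + α + β) 1) / (α + β) =
      ∫ t in (0:ℝ)..1, (t ^ (α + β - 1) * (1 + t) ^ (-β) + t ^ (α + β - 1) * (1 - t) ^ (-β)) := by
    intro α hα
    rw [add_div, tc_hyp α β _ hα h0, tc_hyp α β _ hα h0,
      intervalIntegral.integral_add (tc_integrable_aux2 α β hα h0) (tc_integrable_aux α β hα h0 h1)]
    simp
  have hI : ∀ α : ℝ, 0 < α → IntervalIntegrable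
      (fun t : ℝ => t ^ (α + β - 1) * (1 + t) ^ (-β) + t ^ (α + β - 1) * (1 - t) ^ (-β))
      MeasureTheory.volume 0 1 := fun α hα =>
    (tc_integrable_aux2 α β hα h0).add (tc_integrable_aux α β hα h0 h1)
  have hP : ∀ α : ℝ, 0 < α → IntervalIntegrable (fun t : ℝ => t ^ (α - 1))
      MeasureTheory.volume 0 1 := fun α hα =>
    intervalIntegral.intervalIntegrable_rpow' (by linarith)
  have hPv : ∀ α : ℝ, 0 < α → ∫ t in (0:ℝ)..1, t ^ (α - 1) = 1 / α := by
    intro α hα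
    rw [integral_rpow (Or.inl (by linarith))]
    simp [hα.ne']
  have hmain := intervalIntegral.integral_mono_on_of_le_Ioo (zero_le_one (α := ℝ))
    ((hI a ha0).sub (hI b hb0))
    ((((hP a ha0).sub (hP b hb0)).const_mul (2 * (1 - β))).add
      ((hP a ha0).const_mul (β * (b - a))))
    (fun t ht => tc_pointwise a b β t hab h0 h1 ht.1 ht.2)
  rw [intervalIntegral.integral_sub (hI a ha0) (hI b hb0),
    intervalIntegral.integral_add (((hP a ha0).sub (hP b hb0)).const_mul (2 * (1 - β)))
      ((hP a ha0).const_mul (β * (b - a))),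
    intervalIntegral.integral_const_mul, intervalIntegral.integral_const_mul,
    intervalIntegral.integral_sub (hP a ha0) (hP b hb0), hPv a ha0, hPv b hb0,
    ← hJ a ha0, ← hJ b hb0] at hmain
  have hfin : β * (b - a) * (1 / a) < 2 * β * (1 / a - 1 / b) := by
    have e : 2 * β * (1 / a - 1 / b) = β * (b - a) * (1 / a) * (2 / b) := by
      field_simp
    rw [e]
    have hpos : 0 < β * (b - a) * (1 / a) :=
      mul_pos (mul_pos h0 (by linarith)) (by positivity)
    have : 1 < 2 / b := (one_lt_div hb0).2 hb2
    nlinarith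
  have e1 : (2:ℝ) / a = 2 * (1 / a) := by ring
  have e2 : (2:ℝ) / b = 2 * (1 / b) := by ring
  simp only
  rw [e1, e2]
  linarith
end

section
/- Let R₂(α,β) := -∑_{n=1}^∞ C(β,2n)·2/(2n-α) + 2/α - [₂F₁(-β,α-β,1+α-β;-1) + ₂F₁(-β,α-β,1+α-β;1)]/(α-β) for α ∈ (β,2) and β ∈ (0,1). Then lim_{β→0⁺} R₂(α,β)/β = R₁(α) = -π·cot(πα/2)/α for each fixed α ∈ (0,2). -/
open Real Filter

/-- Generalized binomial coefficient `C(z,k) = z(z-1)⋯(z-k+1)/k!`. -/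
noncomputable def gbinom (z : ℝ) (k : ℕ) : ℝ :=
  (∏ i ∈ Finset.range k, (z - (i : ℝ))) / (Nat.factorial k : ℝ)

/-- The recurrence constant `R₂(α,β)`. -/
noncomputable def R2 (α β : ℝ) : ℝ :=
  -∑' n : ℕ, gbinom β (2 * (n + 1)) * (2 / (2 * ((n : ℝ) + 1) - α)) + 2 / α -
    (hyp2F1 (-β) (α - β) (1 + α - β) (-1) + hyp2F1 (-β) (α - β) (1 + α - β) 1) / (α - β)

/-- `R₁(α) = -π · cot(πα/2) / α`. -/
noncomputable def R1 (α : ℝ) : ℝ :=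
  -π * (Real.cos (π * α / 2) / Real.sin (π * α / 2)) / α

lemma gbinom_succ (β : ℝ) (k : ℕ) :
    gbinom β (k + 1) = β * ((1 / ((k : ℝ) + 1)) *
      ∏ i ∈ Finset.range k, ((β - ((i : ℝ) + 1)) / ((i : ℝ) + 1))) := by
  unfold gbinom
  rw [Finset.prod_range_succ', Finset.prod_div_distrib, Nat.factorial_succ]
  have : (∏ i ∈ Finset.range k, ((i : ℝ) + 1)) = (k.factorial : ℝ) := by
    rw [← Finset.prod_range_add_one_eq_factorial]; push_cast; rfl
  rw [this]
  have h1 : (k.factorial : ℝ) ≠ 0 := by positivity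
  have h2 : (k : ℝ) + 1 ≠ 0 := by positivity
  push_cast
  field_simp
  ring

lemma gbinom_div_bound {β : ℝ} (h0 : 0 < β) (h1 : β < 1) (k : ℕ) :
    |gbinom β (k + 1) / β| ≤ 1 / ((k : ℝ) + 1) := by
  rw [gbinom_succ, mul_div_cancel_left₀ _ h0.ne', abs_mul, abs_of_pos (by positivity)]
  refine mul_le_of_le_one_right (by positivity) ?_
  rw [Finset.abs_prod]
  refine Finset.prod_le_one (fun _ _ => abs_nonneg _) (fun i _ => ?_)
  have hi : (0 : ℝ) ≤ i := by positivity
  rw [abs_div, abs_of_pos (show (0 : ℝ) < i + 1 by positivity), div_le_one (by positivity), abs_le]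
  constructor <;> linarith

lemma gbinom_div_tendsto (k : ℕ) :
    Tendsto (fun β : ℝ => gbinom β (k + 1) / β) (nhdsWithin 0 (Set.Ioi 0))
      (nhds ((1 / ((k : ℝ) + 1)) * (-1) ^ k)) := by
  have hc : Continuous (fun β : ℝ => (1 / ((k : ℝ) + 1)) *
      ∏ i ∈ Finset.range k, ((β - ((i : ℝ) + 1)) / ((i : ℝ) + 1))) := by fun_prop
  have h := (hc.tendsto 0).mono_left (nhdsWithin_le_nhds (s := Set.Ioi (0 : ℝ)))
  have e : (∏ i ∈ Finset.range k, (((0 : ℝ) - ((i : ℝ) + 1)) / ((i : ℝ) + 1))) = (-1) ^ k := by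
    rw [← Finset.card_range k, ← Finset.prod_const, Finset.card_range]
    refine Finset.prod_congr rfl (fun i _ => ?_)
    have : (i : ℝ) + 1 ≠ 0 := by positivity
    field_simp
    ring
  rw [e] at h
  refine h.congr' ?_
  filter_upwards [self_mem_nhdsWithin] with β hβ
  rw [gbinom_succ, mul_div_cancel_left₀ _ (ne_of_gt hβ)]

lemma gbinom_eq_choose (β : ℝ) (k : ℕ) : gbinom β k = Ring.choose β k := by
  rw [Ring.choose_eq_smul, Polynomial.descPochhammer_smeval_eq_ascPochhammer,
    Polynomial.ascPochhammer_smeval_eq_eval, ← descPochhammer_eval_eq_ascPochhammer,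
    descPochhammer_eval_eq_prod_range, smul_eq_mul, gbinom, div_eq_inv_mul]

lemma binom_hasSum (β : ℝ) {t : ℝ} (ht : |t| < 1) :
    HasSum (fun k : ℕ => gbinom β k * t ^ k) ((1 + t) ^ β) := by
  have h := (Real.one_add_rpow_hasFPowerSeriesOnBall_zero (a := β)).hasSum (y := t)
    (by simpa [Metric.mem_eball, edist_zero_right, ← ofReal_norm] using ht)
  simpa only [binomialSeries_apply, gbinom_eq_choose, List.ofFn_const, List.prod_replicate,
    smul_eq_mul, zero_add] using h

lemma binom_even_hasSum (β : ℝ) {t : ℝ} (ht : |t| < 1) :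
    HasSum (fun n : ℕ => 2 * gbinom β (2 * n) * t ^ (2 * n)) ((1 + t) ^ β + (1 - t) ^ β) := by
  have h := (binom_hasSum β ht).add (binom_hasSum β (t := -t) (by simpa using ht))
  rw [← sub_eq_add_neg] at h
  have inj : Function.Injective (fun n : ℕ => 2 * n) := fun a b h => by simpa using h
  rw [← inj.hasSum_iff] at h
  · convert! h using 1
    funext n
    simp only [Function.comp_apply]
    rw [(even_two_mul n).neg_pow]
    ring
  · intro k hk
    have : Odd k := by
      rw [← Nat.not_even_iff_odd]
      rintro ⟨m, rfl⟩
      exact hk ⟨m, by simp; ring⟩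
    simp [this.neg_pow]

lemma integral_eq {β b : ℝ} (h0 : 0 < β) (h1 : β < 1) (hb : 0 < b) :
    HasSum (fun n : ℕ => 2 * gbinom β (2 * n) / (2 * n + b))
      (∫ t in (0:ℝ)..1, t ^ (b - 1) * ((1 + t) ^ β + (1 - t) ^ β)) := by
  have hint : ∀ n : ℕ, ∀ t ∈ Set.Ioc (0 : ℝ) 1, t ^ (b - 1) * t ^ (2 * n) = t ^ (2 * n + b - 1) := by
    intro n t ht
    rw [← Real.rpow_natCast, ← Real.rpow_add ht.1]
    congr 1; push_cast; ring
  have hi0 : ∀ n : ℕ, MeasureTheory.IntegrableOn (fun t : ℝ => t ^ (2 * n + b - 1)) (Set.Ioc 0 1) := by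
    intro n
    rw [← intervalIntegrable_iff_integrableOn_Ioc_of_le zero_le_one]
    exact intervalIntegral.intervalIntegrable_rpow' (by have : (0 : ℝ) ≤ n := by positivity
                                                        linarith)
  have hv0 : ∀ n : ℕ, ∫ t in Set.Ioc (0 : ℝ) 1, t ^ (2 * n + b - 1) = 1 / (2 * n + b) := by
    intro n
    have hn : (0 : ℝ) ≤ n := by positivity
    rw [← intervalIntegral.integral_of_le zero_le_one, integral_rpow (Or.inl (by linarith))]
    have : (2 * (n : ℝ) + b - 1 + 1) = 2 * n + b := by ring
    rw [this, Real.one_rpow, Real.zero_rpow (by positivity), sub_zero]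
  have key := MeasureTheory.hasSum_integral_of_summable_integral_norm
    (μ := MeasureTheory.volume.restrict (Set.Ioc (0 : ℝ) 1))
    (F := fun (n : ℕ) (t : ℝ) => 2 * gbinom β (2 * n) * t ^ (2 * n + b - 1))
    (fun n => (hi0 n).const_mul _) ?_
  · rw [intervalIntegral.integral_of_le zero_le_one]
    convert! key using 1
    · funext n
      rw [MeasureTheory.integral_const_mul, hv0]; ring
    · rw [MeasureTheory.integral_Ioc_eq_integral_Ioo, MeasureTheory.integral_Ioc_eq_integral_Ioo]
      refine MeasureTheory.setIntegral_congr_fun measurableSet_Ioo (fun t ht => ?_)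
      have hs := (binom_even_hasSum β (t := t) (by rw [abs_of_pos ht.1]; exact ht.2)).mul_left
        (t ^ (b - 1))
      rw [← hs.tsum_eq]
      refine tsum_congr (fun n => ?_)
      rw [← hint n t ⟨ht.1, ht.2.le⟩]; ring
  · have e : ∀ n : ℕ, (∫ t in Set.Ioc (0 : ℝ) 1, ‖2 * gbinom β (2 * n) * t ^ (2 * n + b - 1)‖)
        = |2 * gbinom β (2 * n)| * (1 / (2 * n + b)) := by
      intro n
      rw [← hv0, ← MeasureTheory.integral_const_mul]
      refine MeasureTheory.setIntegral_congr_fun measurableSet_Ioc (fun t ht => ?_)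
      rw [norm_mul, Real.norm_eq_abs, Real.norm_eq_abs, abs_of_nonneg (Real.rpow_nonneg ht.1.le _)]
    simp_rw [e]
    rw [← summable_nat_add_iff 1]
    have hsum : Summable (fun n : ℕ => 1 / ((n : ℝ) + 1) ^ 2) := by
      have := (summable_nat_add_iff 1).2 (Real.summable_one_div_nat_pow.2 (one_lt_two))
      simpa using this
    refine Summable.of_nonneg_of_le (fun n => by positivity) (fun n => ?_) hsum
    have hB := gbinom_div_bound h0 h1 (2 * n + 1)
    rw [abs_div, abs_of_pos h0, div_le_iff₀ h0] at hB
    have e2 : 2 * (n + 1) = 2 * n + 1 + 1 := by ring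
    rw [e2, abs_mul, abs_two]
    have hn : (0 : ℝ) < (n : ℝ) + 1 := by positivity
    have h3 : 2 * |gbinom β (2 * n + 1 + 1)| ≤ 1 / ((n : ℝ) + 1) := by
      have : 1 / (((2 * n + 1 : ℕ) : ℝ) + 1) * β ≤ 1 / (((2 * n + 1 : ℕ) : ℝ) + 1) :=
        mul_le_of_le_one_right (by positivity) h1.le
      have e3 : 1 / (((2 * n + 1 : ℕ) : ℝ) + 1) = (1 / ((n : ℝ) + 1)) / 2 := by
        push_cast; field_simp; ring
      linarith
    have h4 : 1 / (2 * ((n + 1 : ℕ) : ℝ) + b) ≤ 1 / ((n : ℝ) + 1) := by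
      apply one_div_le_one_div_of_le hn; push_cast; linarith
    calc _ ≤ 1 / ((n : ℝ) + 1) * (1 / ((n : ℝ) + 1)) :=
          mul_le_mul h3 h4 (by positivity) (by positivity)
      _ = _ := by field_simp

lemma hyp_eq {β b : ℝ} (hb : 0 < b) (z : ℝ) :
    hyp2F1 (-β) b (1 + b) z = b * ∫ t in (0:ℝ)..1, t ^ (b - 1) * (1 - t * z) ^ β := by
  unfold hyp2F1
  have e : 1 + b - b = 1 := by ring
  rw [e, Real.Gamma_one, add_comm 1 b, Real.Gamma_add_one hb.ne', mul_one,
    mul_div_cancel_right₀ _ (Real.Gamma_pos_of_pos hb).ne']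
  simp

lemma rpow_int {β b : ℝ} (h0 : 0 < β) (hb : 0 < b) (z : ℝ) :
    IntervalIntegrable (fun t : ℝ => t ^ (b - 1) * (1 - t * z) ^ β) MeasureTheory.volume 0 1 := by
  refine (intervalIntegral.intervalIntegrable_rpow' (by linarith)).mul_continuousOn ?_
  refine ContinuousOn.rpow_const (by fun_prop) (fun _ _ => Or.inr h0.le)

lemma hyp_sum {β b : ℝ} (h0 : 0 < β) (h1 : β < 1) (hb : 0 < b) :
    HasSum (fun n : ℕ => 2 * gbinom β (2 * n) / (2 * n + b))
      ((hyp2F1 (-β) b (1 + b) (-1) + hyp2F1 (-β) b (1 + b) 1) / b) := by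
  have h := integral_eq h0 h1 hb
  rw [hyp_eq hb, hyp_eq hb, ← mul_add, mul_div_cancel_left₀ _ hb.ne',
    ← intervalIntegral.integral_add (rpow_int h0 hb _) (rpow_int h0 hb _)]
  convert h using 3 with t
  rw [mul_neg_one, sub_neg_eq_add, mul_one, mul_add]

lemma bound_summable (C : ℝ) : Summable (fun n : ℕ => C * (1 / ((n : ℝ) + 1) ^ 2)) := by
  have := (summable_nat_add_iff 1).2 (Real.summable_one_div_nat_pow.2 (one_lt_two))
  exact Summable.mul_left _ (by simpa using this)

lemma term_bound1 {α β : ℝ} (hα : α < 2) (h0 : 0 < β) (h1 : β < 1) (hpos : 0 < α) (n : ℕ) :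
    ‖gbinom β (2 * (n + 1)) / β * (2 / (2 * ((n : ℝ) + 1) - α))‖
      ≤ (1 / (2 - α)) * (1 / ((n : ℝ) + 1) ^ 2) := by
  have hB := gbinom_div_bound h0 h1 (2 * n + 1)
  have e2 : 2 * (n + 1) = 2 * n + 1 + 1 := by ring
  have hn : (0 : ℝ) ≤ n := by positivity
  have hc : 0 < 2 - α := by linarith
  have hd : (2 - α) * ((n : ℝ) + 1) ≤ 2 * ((n : ℝ) + 1) - α := by nlinarith
  have hd' : 0 < (2 - α) * ((n : ℝ) + 1) := by positivity
  rw [e2, norm_mul, Real.norm_eq_abs, Real.norm_eq_abs,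
    abs_of_pos (show 0 < 2 / (2 * ((n : ℝ) + 1) - α) by apply div_pos two_pos; linarith)]
  calc _ ≤ 1 / (((2 * n + 1 : ℕ) : ℝ) + 1) * (2 / ((2 - α) * ((n : ℝ) + 1))) :=
        mul_le_mul hB (by gcongr) (by apply div_nonneg two_pos.le; linarith) (by positivity)
    _ = _ := by push_cast; field_simp; ring

lemma term_bound2 {b β : ℝ} (hb : 0 < b) (h0 : 0 < β) (h1 : β < 1) (n : ℕ) :
    ‖gbinom β (2 * (n + 1)) / β * (2 / (2 * ((n : ℝ) + 1) + b))‖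
      ≤ 1 * (1 / ((n : ℝ) + 1) ^ 2) := by
  have hB := gbinom_div_bound h0 h1 (2 * n + 1)
  have e2 : 2 * (n + 1) = 2 * n + 1 + 1 := by ring
  have hn : (0 : ℝ) ≤ n := by positivity
  rw [e2, norm_mul, Real.norm_eq_abs, Real.norm_eq_abs,
    abs_of_pos (show 0 < 2 / (2 * ((n : ℝ) + 1) + b) by positivity)]
  calc _ ≤ 1 / (((2 * n + 1 : ℕ) : ℝ) + 1) * (2 / ((n : ℝ) + 1)) :=
        mul_le_mul hB (div_le_div_of_nonneg_left two_pos.le (by positivity) (by linarith)) (by positivity) (by positivity)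
    _ = _ := by push_cast; field_simp; ring

lemma R2_eq {α β : ℝ} (hα : α ∈ Set.Ioo (0 : ℝ) 2) (h0 : 0 < β) (h1 : β < 1) (h2 : β < α) :
    R2 α β / β = -(∑' n : ℕ, gbinom β (2 * (n + 1)) / β * (2 / (2 * ((n : ℝ) + 1) - α)))
      - (∑' n : ℕ, gbinom β (2 * (n + 1)) / β * (2 / (2 * ((n : ℝ) + 1) + (α - β))))
      - 2 / (α * (α - β)) := by
  have hb : 0 < α - β := by linarith
  have hs := hyp_sum h0 h1 hb
  have e1 : 1 + α - β = 1 + (α - β) := by ring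
  have hα0 : 0 < α := hα.1
  unfold R2
  rw [e1, ← hs.tsum_eq, hs.summable.tsum_eq_zero_add]
  have g0 : gbinom β (2 * 0) = 1 := by simp [gbinom]
  rw [g0]
  have s1 : (∑' n : ℕ, gbinom β (2 * (n + 1)) / β * (2 / (2 * ((n : ℝ) + 1) - α))) =
      (∑' n : ℕ, gbinom β (2 * (n + 1)) * (2 / (2 * ((n : ℝ) + 1) - α))) / β := by
    rw [← tsum_div_const]; exact tsum_congr fun n => by ring
  have s2 : (∑' n : ℕ, gbinom β (2 * (n + 1)) / β * (2 / (2 * ((n : ℝ) + 1) + (α - β)))) =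
      (∑' n : ℕ, 2 * gbinom β (2 * (n + 1)) / (2 * ((n + 1 : ℕ) : ℝ) + (α - β))) / β := by
    rw [← tsum_div_const]; exact tsum_congr fun n => by push_cast; ring
  rw [s1, s2]
  simp only [Nat.cast_zero, mul_zero, zero_add, mul_one]
  field_simp
  ring

lemma R1_eq {α : ℝ} (hα : α ∈ Set.Ioo (0 : ℝ) 2) :
    R1 α = (∑' n : ℕ, 4 / (4 * ((n : ℝ) + 1) ^ 2 - α ^ 2)) - 2 / α ^ 2 := by
  have hα0 : 0 < α := hα.1
  have hα2 : α < 2 := hα.2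
  have hx : ((α / 2 : ℝ) : ℂ) ∈ Complex.integerComplement := by
    rintro ⟨m, hm⟩
    have hm' : (m : ℝ) = α / 2 := by exact_mod_cast hm
    have a1 : (0 : ℝ) < m := by linarith
    have a2 : (m : ℝ) < 1 := by linarith
    have a1' : 0 < m := by exact_mod_cast a1
    have a2' : m < 1 := by exact_mod_cast a2
    omega
  have h := cot_series_rep' hx
  have h' : π * (Real.cos (π * (α / 2)) / Real.sin (π * (α / 2))) - 1 / (α / 2) =
      ∑' n : ℕ, (1 / (α / 2 - ((n : ℝ) + 1)) + 1 / (α / 2 + ((n : ℝ) + 1))) := by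
    rw [Complex.cot] at h
    exact_mod_cast h
  have e : (∑' n : ℕ, (1 / (α / 2 - ((n : ℝ) + 1)) + 1 / (α / 2 + ((n : ℝ) + 1)))) =
      (-α) * ∑' n : ℕ, 4 / (4 * ((n : ℝ) + 1) ^ 2 - α ^ 2) := by
    rw [← tsum_mul_left]
    refine tsum_congr fun n => ?_
    have hn : (0 : ℝ) ≤ n := by positivity
    have d1 : α / 2 - ((n : ℝ) + 1) ≠ 0 := by linarith
    have d2 : α / 2 + ((n : ℝ) + 1) ≠ 0 := by positivity
    have d3 : 4 * ((n : ℝ) + 1) ^ 2 - α ^ 2 ≠ 0 := by nlinarith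
    rw [div_add_div _ _ d1 d2, mul_div_assoc', div_eq_div_iff (mul_ne_zero d1 d2) d3]
    ring
  rw [e] at h'
  have h3 : π * (Real.cos (π * (α / 2)) / Real.sin (π * (α / 2))) =
      1 / (α / 2) + (-α) * ∑' n : ℕ, 4 / (4 * ((n : ℝ) + 1) ^ 2 - α ^ 2) := by linarith
  unfold R1
  rw [mul_div_assoc π α 2, neg_mul, h3]
  field_simp
  ring

theorem R2_div_beta_tendsto_R1 (α : ℝ) (hα : α ∈ Set.Ioo (0 : ℝ) 2) :
    Tendsto (fun β : ℝ => R2 α β / β) (nhdsWithin 0 (Set.Ioi 0)) (nhds (R1 α)) := by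
  have hα0 : 0 < α := hα.1
  have hα2 : α < 2 := hα.2
  have ev1 : ∀ᶠ β : ℝ in nhdsWithin 0 (Set.Ioi 0), 0 < β := self_mem_nhdsWithin
  have ev2 : ∀ᶠ β : ℝ in nhdsWithin 0 (Set.Ioi 0), β < 1 :=
    nhdsWithin_le_nhds (Iio_mem_nhds one_pos)
  have ev3 : ∀ᶠ β : ℝ in nhdsWithin 0 (Set.Ioi 0), β < α :=
    nhdsWithin_le_nhds (Iio_mem_nhds hα0)
  have hid : Tendsto (fun β : ℝ => β) (nhdsWithin 0 (Set.Ioi 0)) (nhds 0) :=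
    tendsto_id.mono_left nhdsWithin_le_nhds
  have hab : Tendsto (fun β : ℝ => α - β) (nhdsWithin 0 (Set.Ioi 0)) (nhds α) := by
    simpa using hid.const_sub α
  have hg : ∀ n : ℕ, Tendsto (fun β : ℝ => gbinom β (2 * (n + 1)) / β)
      (nhdsWithin 0 (Set.Ioi 0)) (nhds (-(1 / (2 * ((n : ℝ) + 1))))) := by
    intro n
    have h := gbinom_div_tendsto (2 * n + 1)
    have e : (1 / (((2 * n + 1 : ℕ) : ℝ) + 1) * (-1) ^ (2 * n + 1)) =
        -(1 / (2 * ((n : ℝ) + 1))) := by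
      rw [Odd.neg_one_pow ⟨n, rfl⟩]; push_cast; ring
    rw [e] at h
    exact h
  have t1 := tendsto_tsum_of_dominated_convergence
    (f := fun (β : ℝ) (n : ℕ) => gbinom β (2 * (n + 1)) / β * (2 / (2 * ((n : ℝ) + 1) - α)))
    (bound_summable (1 / (2 - α)))
    (fun n => (hg n).mul_const _)
    (by filter_upwards [ev1, ev2] with β h0 h1 n using term_bound1 hα2 h0 h1 hα0 n)
  have t2 := tendsto_tsum_of_dominated_convergence
    (f := fun (β : ℝ) (n : ℕ) =>
      gbinom β (2 * (n + 1)) / β * (2 / (2 * ((n : ℝ) + 1) + (α - β))))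
    (bound_summable 1)
    (fun n => (hg n).mul ((tendsto_const_nhds (x := (2 : ℝ))).div
      (hab.const_add (2 * ((n : ℝ) + 1))) (by positivity)))
    (by filter_upwards [ev1, ev2, ev3] with β h0 h1 h2 n
        exact term_bound2 (by linarith) h0 h1 n)
  have t3 : Tendsto (fun β : ℝ => 2 / (α * (α - β))) (nhdsWithin 0 (Set.Ioi 0))
      (nhds (2 / (α * α))) :=
    (tendsto_const_nhds (x := (2 : ℝ))).div (hab.const_mul α) (by positivity)
  have sm1 : Summable (fun n : ℕ => -(1 / (2 * ((n : ℝ) + 1))) * (2 / (2 * ((n : ℝ) + 1) - α))) := by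
    refine Summable.of_norm_bounded (bound_summable (1 / (2 - α))) (fun n => ?_)
    refine le_of_tendsto ((hg n).mul_const _).norm ?_
    filter_upwards [ev1, ev2] with β h0 h1 using term_bound1 hα2 h0 h1 hα0 n
  have sm2 : Summable (fun n : ℕ => -(1 / (2 * ((n : ℝ) + 1))) * (2 / (2 * ((n : ℝ) + 1) + α))) := by
    refine Summable.of_norm_bounded (bound_summable 1) (fun n => ?_)
    refine le_of_tendsto ((hg n).mul_const _).norm ?_
    filter_upwards [ev1, ev2] with β h0 h1 using term_bound2 hα0 h0 h1 n
  have t := (t1.neg.sub t2).sub t3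
  have hR : -(∑' n : ℕ, -(1 / (2 * ((n : ℝ) + 1))) * (2 / (2 * ((n : ℝ) + 1) - α)))
      - (∑' n : ℕ, -(1 / (2 * ((n : ℝ) + 1))) * (2 / (2 * ((n : ℝ) + 1) + α))) - 2 / (α * α)
      = R1 α := by
    rw [R1_eq hα, ← neg_add', ← sm1.tsum_add sm2, ← tsum_neg, ← pow_two]
    congr 1
    refine tsum_congr fun n => ?_
    have hn : (0 : ℝ) ≤ n := by positivity
    have d1 : 2 * ((n : ℝ) + 1) - α ≠ 0 := by linarith
    have d2 : 2 * ((n : ℝ) + 1) + α ≠ 0 := by positivity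
    have d3 : 4 * ((n : ℝ) + 1) ^ 2 - α ^ 2 = (2 * ((n : ℝ) + 1) - α) * (2 * ((n : ℝ) + 1) + α) := by
      ring
    rw [d3]
    field_simp
    ring
  rw [hR] at t
  refine t.congr' ?_
  filter_upwards [ev1, ev2, ev3] with β h0 h1 h2
  exact (R2_eq hα h0 h1 h2).symm
end
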